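/- arXiv:2004.10194 — 2 statements merged into one kernel-verified Lean document; each statement's English description precedes it below -/
import Mathlib

section
/- Let U : ℝ → ℝ be Lipschitz such that at every point x the one-sided derivatives U'₋(x) and U'₊(x) exist and the set {x : U'₋(x) ≠ U'₊(x)} is countable; let ∂U(x) be the closed segment between U'₋(x) and U'₊(x). Fix θ₀ with 0 ∈ ∂U(θ₀), set E = U(θ₀), assume U(θ) < E for all θ in a punctured right neighbourhood of θ₀, and assume ∫_{θ₀}^{θ₀+ε₀} (E − U(ψ))^{−1/2} dψ < ∞ for some ε₀ > 0. Then there exists τ > 0 such that for every t₊ ≥ 0 there is a solution θ̂ : [0, t₊ + τ] → ℝ of θ'' ∈ −∂U(θ) with θ̂(0) = θ₀, θ̂'(0) = 0, θ̂(t) = θ₀ for all t ∈ [0, t₊], θ̂'(t) > 0 for all t ∈ (t₊, t₊ + τ), and √2·(t − t₊) = ∫_{θ₀}^{θ̂(t)} (E − U(ψ))^{−1/2} dψ for t ∈ (t₊, t₊ + τ]. In particular, the initial value problem θ(0) = θ₀, θ'(0) = 0 has infinitely many pairwise distinct solutions. -/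
open MeasureTheory

/-- `θ` (with derivative `θd`) is a solution on the set `I` of the differential inclusion
`θ'' ∈ -∂U(θ)`, where `∂U(x)` is the segment between the one-sided derivatives `dm x`, `dp x`. -/
def SolInclusionOn (dm dp θ θd : ℝ → ℝ) (I : Set ℝ) : Prop :=
  (∀ t ∈ I, HasDerivWithinAt θ (θd t) I t) ∧ (∃ K : NNReal, LipschitzOnWith K θd I) ∧
    ∀ᵐ t ∂MeasureTheory.volume, t ∈ I → ∃ d : ℝ, HasDerivWithinAt θd d I t ∧
      -d ∈ Set.uIcc (dm (θ t)) (dp (θ t))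

open Set Filter Topology

/-- A continuous strictly monotone function on a compact interval agrees there with an order
isomorphism of the real line. -/
theorem exists_orderIso_eqOn_Icc {F : ℝ → ℝ} {a b : ℝ} (hab : a ≤ b)
    (hc : ContinuousOn F (Icc a b)) (hm : StrictMonoOn F (Icc a b)) :
    ∃ e : ℝ ≃o ℝ, EqOn e F (Icc a b) := by
  set p : ℝ → ℝ := fun x => max a (min b x) with hp
  have hpmem : ∀ x, p x ∈ Icc a b := fun x =>
    ⟨le_max_left _ _, max_le hab (min_le_left _ _)⟩
  have hpc : Continuous p := by fun_prop
  set G : ℝ → ℝ := fun x => F (p x) + (x - p x) with hG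
  have hGc : Continuous G :=
    (hc.comp_continuous hpc hpmem).add (continuous_id.sub hpc)
  have hGm : StrictMono G := by
    intro x y hxy
    have h1 : p x ≤ p y := max_le_max_left _ (min_le_min_left _ hxy.le)
    have h2 : p y - p x ≤ y - x := by
      simp only [hp]
      grind
    rcases h1.eq_or_lt with h | h
    · simp only [hG, h]
      linarith
    · have := hm (hpmem x) (hpmem y) h
      simp only [hG]
      linarith
  have hle : ∀ x, F a ≤ F (p x) ∧ F (p x) ≤ F b := fun x =>
    ⟨hm.monotoneOn (left_mem_Icc.2 hab) (hpmem x) (hpmem x).1,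
      hm.monotoneOn (hpmem x) (right_mem_Icc.2 hab) (hpmem x).2⟩
  have htop : Tendsto G atTop atTop := by
    refine tendsto_atTop_mono (f := fun x => x + (F a - b)) (fun x => ?_)
      (tendsto_atTop_add_const_right _ _ tendsto_id)
    have := (hle x).1
    have := (hpmem x).2
    simp only [hG]
    linarith
  have hbot : Tendsto G atBot atBot := by
    refine tendsto_atBot_mono (f := fun x => x + (F b - a)) (fun x => ?_)
      (tendsto_atBot_add_const_right _ _ tendsto_id)
    have := (hle x).2
    have := (hpmem x).1
    simp only [hG]
    linarith
  refine ⟨hGm.orderIsoOfSurjective G (hGc.surjective htop hbot), fun x hx => ?_⟩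
  have : p x = x := by simp [hp, hx.1, hx.2]
  simp [hG, this]

/-- Solving the scalar equation `φ' = √2 * w φ` by separation of variables, starting from a zero
`a` of `w` at which `1 / w` is integrable. -/
theorem exists_separated_solution {w : ℝ → ℝ} {a b : ℝ} (hab : a < b) (hw : Continuous w)
    (hwa : w a = 0) (hpos : ∀ x ∈ Ioc a b, 0 < w x)
    (hint : IntervalIntegrable (fun x => (w x)⁻¹) volume a b) :
    ∃ T > (0 : ℝ), ∃ φ : ℝ → ℝ, (∀ s ≤ 0, φ s = a) ∧
      (∀ s < T, HasDerivAt φ (√2 * w (φ s)) s) ∧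
      (∀ s ∈ Ioo 0 T, φ s ∈ Ioo a b) ∧ StrictMonoOn φ (Ici 0) ∧ Continuous φ ∧
      ∀ s ∈ Ioo 0 T, √2 * s = ∫ x in a..φ s, (w x)⁻¹ := by
  have h2 : (0 : ℝ) < √2 := by positivity
  set F : ℝ → ℝ := fun y => ∫ x in a..y, (w x)⁻¹ with hF
  have hsub : ∀ x ∈ Icc a b, ∀ y ∈ Icc a b,
      IntervalIntegrable (fun x => (w x)⁻¹) volume x y := fun x hx y hy =>
    hint.mono_set (by
      rw [uIcc_of_le hab.le]
      exact (convex_Icc a b).ordConnected.uIcc_subset hx hy)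
  have ha : a ∈ Icc a b := left_mem_Icc.2 hab.le
  have hFc : ContinuousOn F (Icc a b) := by
    have := intervalIntegral.continuousOn_primitive_interval' hint left_mem_uIcc
    rwa [uIcc_of_le hab.le] at this
  have hFm : StrictMonoOn F (Icc a b) := by
    intro x hx y hy hxy
    have h := intervalIntegral.integral_add_adjacent_intervals (hsub a ha x hx) (hsub x hx y hy)
    have := intervalIntegral.intervalIntegral_pos_of_pos_on (hsub x hx y hy)
      (fun z hz => inv_pos.2 (hpos z ⟨hx.1.trans_lt hz.1, hz.2.le.trans hy.2⟩)) hxy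
    simp only [hF]
    linarith
  obtain ⟨e, he⟩ := exists_orderIso_eqOn_Icc hab.le hFc hFm
  have hea : e a = 0 := by rw [he ha]; simp [hF]
  have hsa : e.symm 0 = a := by rw [← hea]; simp
  have heb : 0 < e b := hea ▸ e.strictMono hab
  set φ : ℝ → ℝ := fun s => e.symm (√2 * max s 0) with hφ
  have hφ0 : ∀ s ≤ 0, φ s = a := fun s hs => by simp [hφ, hs, hsa]
  have hφc : Continuous φ := e.symm.continuous.comp (by fun_prop)
  have hφmem : ∀ s ∈ Ioo 0 (e b / √2), φ s ∈ Ioo a b := by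
    intro s hs
    have hs' : √2 * s < e b := by rw [mul_comm]; exact (lt_div_iff₀ h2).1 hs.2
    simp only [hφ, max_eq_left hs.1.le]
    refine ⟨e.lt_symm_apply.2 ?_, e.symm_apply_lt.2 hs'⟩
    rw [hea]
    exact mul_pos h2 hs.1
  have hne : ∀ s < e b / √2, s ≠ 0 → HasDerivAt φ (√2 * w (φ s)) s := by
    intro s hs hs0
    rcases hs0.lt_or_gt with h | h
    · have : φ =ᶠ[𝓝 s] fun _ => a := by
        filter_upwards [Iio_mem_nhds h] with r hr using hφ0 r (le_of_lt hr)
      rw [hφ0 s h.le, hwa, mul_zero]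
      exact (hasDerivAt_const s a).congr_of_eventuallyEq this
    · have hm := hφmem s ⟨h, hs⟩
      have hwp := hpos _ ⟨hm.1, hm.2.le⟩
      have hFd : HasDerivAt F (w (φ s))⁻¹ (φ s) := by
        refine intervalIntegral.integral_hasDerivAt_right (hsub a ha _ ⟨hm.1.le, hm.2.le⟩) ?_ ?_
        · exact hw.measurable.inv.stronglyMeasurable.stronglyMeasurableAtFilter
        · exact hw.continuousAt.inv₀ hwp.ne'
      have hed : HasDerivAt e (w (φ s))⁻¹ (e.symm (√2 * s)) := by
        have hs' : φ s = e.symm (√2 * s) := by simp [hφ, max_eq_left h.le]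
        rw [← hs']
        refine hFd.congr_of_eventuallyEq ?_
        filter_upwards [Ioo_mem_nhds hm.1 hm.2] with x hx using he ⟨hx.1.le, hx.2.le⟩
      have hsd := HasDerivAt.of_local_left_inverse (f := e) (g := e.symm)
        e.symm.continuous.continuousAt hed (inv_ne_zero hwp.ne')
        (Eventually.of_forall fun x => e.apply_symm_apply x)
      have := hsd.comp s ((hasDerivAt_id s).const_mul (√2))
      rw [inv_inv, mul_one, mul_comm] at this
      refine this.congr_of_eventuallyEq ?_
      filter_upwards [Ioi_mem_nhds h] with r hr
      simp [hφ, max_eq_left (le_of_lt (mem_Ioi.1 hr))]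
  refine ⟨e b / √2, by positivity, φ, hφ0, fun s hs => ?_, hφmem, ?_, hφc, ?_⟩
  · rcases eq_or_ne s 0 with rfl | h
    · have hcont : Tendsto (fun r => √2 * w (φ r)) (𝓝[>] 0) (𝓝 (√2 * w (φ 0))) :=
        ((continuous_const.mul (hw.comp hφc)).tendsto 0).mono_left nhdsWithin_le_nhds
      have hr : HasDerivWithinAt φ (√2 * w (φ 0)) (Ici 0) 0 := by
        refine hasDerivWithinAt_Ici_of_tendsto_deriv (s := Ioo 0 (e b / √2))
          (fun r hr => (hne r hr.2 hr.1.ne').differentiableAt.differentiableWithinAt)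
          hφc.continuousWithinAt (Ioo_mem_nhdsGT hs) (hcont.congr' ?_)
        filter_upwards [Ioo_mem_nhdsGT hs] with r hr using (hne r hr.2 hr.1.ne').deriv.symm
      have hl : HasDerivWithinAt φ (√2 * w (φ 0)) (Iic 0) 0 := by
        rw [hφ0 0 le_rfl, hwa, mul_zero]
        exact (hasDerivWithinAt_const _ _ a).congr (fun r hr => hφ0 r hr) (hφ0 0 le_rfl)
      have := hl.union hr
      rwa [Iic_union_Ici, hasDerivWithinAt_univ] at this
    · exact hne s hs h
  · intro r hr s hs hrs
    simp only [hφ, max_eq_left (mem_Ici.1 hr), max_eq_left (mem_Ici.1 hs)]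
    exact e.symm.strictMono (by gcongr)
  · intro s hs
    have hm := hφmem s hs
    change _ = F (φ s)
    rw [← he ⟨hm.1.le, hm.2.le⟩]
    simp [hφ, max_eq_left hs.1.le]

/-- If `u` has derivative `d` at `x` from within `s`, `φ` maps `t` to `s` near the point, `φ`
solves `φ' = √2 * √(E - u φ)` and `u (φ r) < E`, then `√2 * √(E - u φ)` has derivative `-d`. -/
theorem hasDerivWithinAt_speed {u φ : ℝ → ℝ} {d E r : ℝ} {s t : Set ℝ}
    (hu : HasDerivWithinAt u d s (φ r)) (hφ : HasDerivAt φ (√2 * √(E - u (φ r))) r)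
    (hst : MapsTo φ t s) (hlt : u (φ r) < E) :
    HasDerivWithinAt (fun r => √2 * √(E - u (φ r))) (-d) t r := by
  have hpos : 0 < E - u (φ r) := sub_pos.2 hlt
  have hc := hu.comp r hφ.hasDerivWithinAt hst
  have := ((hc.const_sub E).sqrt hpos.ne').const_mul (√2)
  refine this.congr_deriv ?_
  have h1 : √(E - u (φ r)) ≠ 0 := (Real.sqrt_pos.2 hpos).ne'
  simp only [Function.comp]
  field_simp
  rw [Real.sq_sqrt (by norm_num)]
  ring

theorem abs_le_of_lipschitzWith_of_hasDerivWithinAt_Ici {u : ℝ → ℝ} {K : NNReal}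
    (hu : LipschitzWith K u) {d x : ℝ} (hd : HasDerivWithinAt u d (Ici x) x) : |d| ≤ K := by
  have h := (hasDerivWithinAt_iff_tendsto_slope' self_notMem_Ioi).1 hd.Ioi_of_Ici
  refine le_of_tendsto h.abs ?_
  filter_upwards [self_mem_nhdsWithin] with y hy
  have hy' : 0 < |y - x| := abs_pos.2 (sub_pos.2 hy).ne'
  rw [slope_def_field, abs_div, div_le_iff₀ hy']
  exact hu.dist_le_mul y x

theorem SolInclusionOn.mono {dm dp θ θd : ℝ → ℝ} {I J : Set ℝ}
    (h : SolInclusionOn dm dp θ θd I) (hJ : J ⊆ I) : SolInclusionOn dm dp θ θd J := by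
  obtain ⟨h1, ⟨K, hK⟩, h3⟩ := h
  refine ⟨fun t ht => (h1 t (hJ ht)).mono hJ, ⟨K, hK.mono hJ⟩, ?_⟩
  filter_upwards [h3] with t h ht
  obtain ⟨d, hd, hm⟩ := h (hJ ht)
  exact ⟨d, hd.mono hJ, hm⟩

theorem SolInclusionOn.comp_sub_const {dm dp θ θd : ℝ → ℝ} {I : Set ℝ}
    (h : SolInclusionOn dm dp θ θd I) (c : ℝ) :
    SolInclusionOn dm dp (fun t => θ (t - c)) (fun t => θd (t - c)) ((fun t => t - c) ⁻¹' I) := by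
  have key : ∀ {f : ℝ → ℝ} {f' t : ℝ}, HasDerivWithinAt f f' I (t - c) →
      HasDerivWithinAt (fun t => f (t - c)) f' ((fun t => t - c) ⁻¹' I) t := by
    intro f f' t hf
    have := hf.comp (h := fun t => t - c) t
      (((hasDerivAt_id t).sub_const c).hasDerivWithinAt (s := (fun t => t - c) ⁻¹' I))
      (mapsTo_preimage _ _)
    rwa [mul_one] at this
  obtain ⟨h1, ⟨K, hK⟩, h3⟩ := h
  refine ⟨fun t ht => key (h1 _ ht), ⟨K, fun x hx y hy => ?_⟩, ?_⟩
  · simpa using hK hx hy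
  · have := (measurePreserving_sub_right volume c).quasiMeasurePreserving.ae h3
    filter_upwards [this] with t h ht
    obtain ⟨d, hd, hm⟩ := h ht
    exact ⟨d, key hd, hm⟩

/-- A solution which stays at the top of the potential up to time `0` and then leaves it. -/
theorem exists_escaping_solution (U dm dp : ℝ → ℝ) (K : NNReal) (hU : LipschitzWith K U)
    (hdm : ∀ x : ℝ, HasDerivWithinAt U (dm x) (Set.Iic x) x)
    (hdp : ∀ x : ℝ, HasDerivWithinAt U (dp x) (Set.Ici x) x)
    (hcnt : {x : ℝ | dm x ≠ dp x}.Countable)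
    (θ₀ : ℝ) (h0 : (0 : ℝ) ∈ Set.uIcc (dm θ₀) (dp θ₀))
    (E : ℝ) (hE : E = U θ₀)
    (hpot : ∃ ε > (0 : ℝ), ∀ θ ∈ Set.Ioo θ₀ (θ₀ + ε), U θ < E)
    (hint : ∃ ε₀ > (0 : ℝ),
      IntervalIntegrable (fun ψ => (Real.sqrt (E - U ψ))⁻¹) volume θ₀ (θ₀ + ε₀)) :
    ∃ T > (0 : ℝ), ∃ φ v : ℝ → ℝ, SolInclusionOn dm dp φ v (Iio T) ∧
      (∀ s ≤ 0, φ s = θ₀) ∧ (∀ s ≤ 0, v s = 0) ∧ (∀ s ∈ Ioo 0 T, 0 < v s) ∧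
      ∀ s ∈ Ioo 0 T, √2 * s = ∫ ψ in θ₀..φ s, (√(E - U ψ))⁻¹ := by
  obtain ⟨ε, hε, hpot⟩ := hpot
  obtain ⟨ε₀, hε₀, hint⟩ := hint
  obtain ⟨δ, hδ, hδmin⟩ := exists_between (lt_min hε hε₀)
  obtain ⟨hδε, hδε₀⟩ := lt_min_iff.1 hδmin
  have hlt : ∀ x ∈ Ioc θ₀ (θ₀ + δ), U x < E := fun x hx =>
    hpot x ⟨hx.1, hx.2.trans_lt (by linarith)⟩
  have hw : Continuous fun x => √(E - U x) := by
    have := hU.continuous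
    fun_prop
  obtain ⟨T, hT, φ, hφ0, hφd, hφmem, hφm, hφc, hφint⟩ :=
    exists_separated_solution (w := fun x => √(E - U x)) (a := θ₀) (b := θ₀ + δ) (by linarith) hw
      (by simp [hE]) (fun x hx => Real.sqrt_pos.2 (sub_pos.2 (hlt x hx)))
      (hint.mono_set (by
        rw [uIcc_of_le (by linarith), uIcc_of_le (by linarith)]
        exact Icc_subset_Icc_right (by linarith)))
  have hlt' : ∀ s ∈ Ioo 0 T, U (φ s) < E := fun s hs =>
    hlt _ ⟨(hφmem s hs).1, (hφmem s hs).2.le⟩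
  set v : ℝ → ℝ := fun s => √2 * √(E - U (φ s)) with hv
  have hvc : Continuous v := continuous_const.mul (hw.comp hφc)
  have hv0 : ∀ s ≤ 0, v s = 0 := fun s hs => by simp [hv, hφ0 s hs, hE]
  have hright : ∀ s ∈ Ioo 0 T, HasDerivWithinAt v (-dp (φ s)) (Ici s) s := fun s hs =>
    hasDerivWithinAt_speed (hdp _) (hφd s hs.2)
      (fun r hr => hφm.monotoneOn hs.1.le (hs.1.le.trans hr) hr) (hlt' s hs)
  have hlip : ∀ x ∈ Ioo 0 T, ∀ y ∈ Ioo 0 T, x ≤ y → |v y - v x| ≤ K * (y - x) := by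
    intro x hx y hy hxy
    refine norm_image_sub_le_of_norm_deriv_right_le_segment (f := v) (f' := fun s => -dp (φ s))
      hvc.continuousOn (fun s hs => hright s ⟨hx.1.trans_le hs.1, hs.2.trans hy.2⟩)
      (fun s hs => ?_) y ⟨hxy, le_rfl⟩
    rw [norm_neg]
    exact abs_le_of_lipschitzWith_of_hasDerivWithinAt_Ici hU (hdp _)
  have hlip0 : ∀ y ∈ Ioo 0 T, |v y| ≤ K * y := by
    intro y hy
    have hl : Tendsto (fun x => |v y - v x|) (𝓝[>] 0) (𝓝 |v y - v 0|) :=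
      ((continuous_const.sub hvc).abs.tendsto 0).mono_left nhdsWithin_le_nhds
    have hr : Tendsto (fun x : ℝ => K * (y - x)) (𝓝[>] 0) (𝓝 (K * (y - 0))) :=
      ((by fun_prop : Continuous fun x : ℝ => (K : ℝ) * (y - x)).tendsto 0).mono_left
        nhdsWithin_le_nhds
    have := le_of_tendsto_of_tendsto hl hr (by
      filter_upwards [Ioo_mem_nhdsGT hy.1] with x hx
      exact hlip x ⟨hx.1, hx.2.trans hy.2⟩ y hy hx.2.le)
    simpa [hv0 0 le_rfl] using this
  have hlipT : LipschitzOnWith K v (Iio T) := by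
    refine LipschitzOnWith.of_dist_le_mul fun x hx y hy => ?_
    wlog hxy : y ≤ x generalizing x y
    · rw [dist_comm, dist_comm x]
      exact this y hy x hx (le_of_not_ge hxy)
    rw [Real.dist_eq, Real.dist_eq, abs_of_nonneg (sub_nonneg.2 hxy)]
    rcases le_or_gt x 0 with h | h
    · rw [hv0 x h, hv0 y (hxy.trans h)]
      simpa using mul_nonneg K.2 (sub_nonneg.2 hxy)
    rcases le_or_gt y 0 with h' | h'
    · rw [hv0 y h', sub_zero]
      refine (hlip0 x ⟨h, hx⟩).trans ?_
      gcongr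
      linarith
    · exact hlip y ⟨h', hy⟩ x ⟨h, hx⟩ hxy
  refine ⟨T, hT, φ, v, ⟨fun s hs => (hφd s hs).hasDerivWithinAt, ⟨K, hlipT⟩, ?_⟩, hφ0, hv0,
    fun s hs => mul_pos (by positivity) (Real.sqrt_pos.2 (sub_pos.2 (hlt' s hs))), hφint⟩
  have hbad : (Ici 0 ∩ φ ⁻¹' {x | dm x ≠ dp x}).Countable :=
    MapsTo.countable_of_injOn (f := φ) (fun s hs => hs.2)
      (hφm.injOn.mono inter_subset_left) hcnt
  filter_upwards [hbad.ae_notMem volume, (countable_singleton (0 : ℝ)).ae_notMem volume]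
    with s hs hs0 hsT
  rcases lt_or_gt_of_ne hs0 with h | h
  · refine ⟨0, ?_, by simpa [hφ0 s h.le] using h0⟩
    refine ((hasDerivAt_const s (0 : ℝ)).congr_of_eventuallyEq ?_).hasDerivWithinAt
    filter_upwards [Iio_mem_nhds h] with r hr using hv0 r (le_of_lt hr)
  · have heq : dm (φ s) = dp (φ s) := by
      by_contra hne
      exact hs ⟨h.le, hne⟩
    refine ⟨-dp (φ s), ?_, by simp⟩
    have hUd : HasDerivWithinAt U (dp (φ s)) univ (φ s) := by
      rw [← Iic_union_Ici (a := φ s)]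
      exact (heq ▸ hdm (φ s)).union (hdp (φ s))
    exact (hasDerivWithinAt_speed hUd (hφd s hsT) (mapsTo_univ _ univ)
      (hlt' s ⟨h, hsT⟩)).mono (subset_univ _)

/-- Item (2) of the theorem on absence of uniqueness: if `0 ∈ ∂U(θ₀)`,
`E = U(θ₀)`, `U < E` on a punctured right neighbourhood of `θ₀`, and `(E - U)^{-1/2}` is
integrable on `[θ₀, θ₀ + ε₀]` for some `ε₀ > 0`, then there is `τ > 0` such that for every
`t₊ ≥ 0` there is a solution staying at `θ₀` on `[0, t₊]` and strictly moving right on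
`(t₊, t₊ + τ)` with the integral time law; in particular the initial value problem has
infinitely many pairwise distinct solutions. -/
theorem stmt_9 (U dm dp : ℝ → ℝ) (K : NNReal) (hU : LipschitzWith K U)
    (hdm : ∀ x : ℝ, HasDerivWithinAt U (dm x) (Set.Iic x) x)
    (hdp : ∀ x : ℝ, HasDerivWithinAt U (dp x) (Set.Ici x) x)
    (hcnt : {x : ℝ | dm x ≠ dp x}.Countable)
    (θ₀ : ℝ) (h0 : (0 : ℝ) ∈ Set.uIcc (dm θ₀) (dp θ₀))
    (E : ℝ) (hE : E = U θ₀)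
    (hpot : ∃ ε > (0 : ℝ), ∀ θ ∈ Set.Ioo θ₀ (θ₀ + ε), U θ < E)
    (hint : ∃ ε₀ > (0 : ℝ),
      IntervalIntegrable (fun ψ => (Real.sqrt (E - U ψ))⁻¹) volume θ₀ (θ₀ + ε₀)) :
    (∃ τ > (0 : ℝ), ∀ tp : ℝ, 0 ≤ tp → ∃ θ θd : ℝ → ℝ,
      SolInclusionOn dm dp θ θd (Set.Icc 0 (tp + τ)) ∧ θ 0 = θ₀ ∧ θd 0 = 0 ∧
      (∀ t ∈ Set.Icc 0 tp, θ t = θ₀) ∧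
      (∀ t ∈ Set.Ioo tp (tp + τ), 0 < θd t) ∧
      (∀ t ∈ Set.Ioc tp (tp + τ),
        Real.sqrt 2 * (t - tp) = ∫ ψ in θ₀..(θ t), (Real.sqrt (E - U ψ))⁻¹)) ∧
    (∃ T > (0 : ℝ), ∃ Θ Θd : ℕ → ℝ → ℝ,
      (∀ n : ℕ, SolInclusionOn dm dp (Θ n) (Θd n) (Set.Icc 0 T) ∧
        Θ n 0 = θ₀ ∧ Θd n 0 = 0) ∧
      ∀ m n : ℕ, m ≠ n → ∃ t ∈ Set.Icc (0 : ℝ) T, Θ m t ≠ Θ n t) := by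
  obtain ⟨T, hT, φ, v, hsol, hφ0, hv0, hvpos, hφint⟩ :=
    exists_escaping_solution U dm dp K hU hdm hdp hcnt θ₀ h0 E hE hpot hint
  have main : ∃ τ > (0 : ℝ), ∀ tp : ℝ, 0 ≤ tp → ∃ θ θd : ℝ → ℝ,
      SolInclusionOn dm dp θ θd (Set.Icc 0 (tp + τ)) ∧ θ 0 = θ₀ ∧ θd 0 = 0 ∧
      (∀ t ∈ Set.Icc 0 tp, θ t = θ₀) ∧
      (∀ t ∈ Set.Ioo tp (tp + τ), 0 < θd t) ∧
      (∀ t ∈ Set.Ioc tp (tp + τ),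
        Real.sqrt 2 * (t - tp) = ∫ ψ in θ₀..(θ t), (Real.sqrt (E - U ψ))⁻¹) := by
    refine ⟨T / 2, by positivity, fun tp htp => ⟨fun t => φ (t - tp), fun t => v (t - tp),
      (hsol.comp_sub_const tp).mono fun t ht => ?_, hφ0 _ (by linarith), hv0 _ (by linarith),
      fun t ht => hφ0 _ (by linarith [ht.2]), fun t ht => hvpos _ ?_, fun t ht => hφint _ ?_⟩⟩
    · have := ht.2
      simp only [mem_preimage, mem_Iio]
      linarith
    · exact ⟨by linarith [ht.1], by linarith [ht.2]⟩
    · exact ⟨by linarith [ht.1], by linarith [ht.2]⟩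
  refine ⟨main, ?_⟩
  obtain ⟨τ, hτ, main⟩ := main
  have hpos : ∀ n : ℕ, 0 < τ / (n + 1) := fun n => by positivity
  choose Θ Θd hsol h0 hd0 hrest _ htime using fun n : ℕ => main (τ / (n + 1)) (hpos n).le
  refine ⟨τ, hτ, Θ, Θd, fun n => ⟨(hsol n).mono (Icc_subset_Icc_right ?_), h0 n, hd0 n⟩, ?_⟩
  · linarith [hpos n]
  have hle : ∀ n : ℕ, τ / (n + 1) ≤ τ := fun n => div_le_self hτ.le (by simp)
  have hlt : ∀ m n : ℕ, m < n → ∃ t ∈ Set.Icc (0 : ℝ) τ, Θ m t ≠ Θ n t := by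
    intro m n hmn
    refine ⟨τ / (m + 1), ⟨(hpos m).le, hle m⟩, fun h => ?_⟩
    have hlt : τ / ((n : ℝ) + 1) < τ / (m + 1) := by gcongr
    have h1 := htime n (τ / (m + 1)) ⟨hlt, by linarith [hle m, hpos n]⟩
    rw [← h, hrest m _ ⟨(hpos m).le, le_rfl⟩, intervalIntegral.integral_same] at h1
    have : 0 < √2 * (τ / ((m : ℝ) + 1) - τ / (n + 1)) :=
      mul_pos (by positivity) (sub_pos.2 hlt)
    linarith
  intro m n hmn
  rcases hmn.lt_or_gt with h | h
  · exact hlt m n h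
  · obtain ⟨t, ht, hne⟩ := hlt n m h
    exact ⟨t, ht, hne.symm⟩
end

section
/- Let Ω ⊂ ℝ² be a compact convex set with 0 in its interior and s_Ω(x) = sup_{v ∈ Ω}⟨x, v⟩ its support function. Let (x, y) : [0, T] → ℝ × (0, ∞) be Lipschitz and u : [0, T] → Ω measurable with x' = y u₁ and y' = y u₂ a.e.; let p ∈ ℝ be a constant and q : [0, T] → ℝ Lipschitz with q'(t) = −(p u₁(t) + q(t) u₂(t)) a.e.; and assume the maximality condition p y(t) u₁(t) + q(t) y(t) u₂(t) = s_Ω(p y(t), q(t) y(t)) for a.e. t. Then: (a) H := s_Ω(p y(t), q(t) y(t)) is constant on [0, T]; (b) C := p x(t) + q(t) y(t) is constant on [0, T]; consequently, if p ≠ 0, the whole trajectory lies in the curve {(x, y) : s_Ω(p y, C − p x) = H}, i.e. on a copy of the boundary of the polar set Ω° rotated by ±90°, dilated by H/|p| and translated horizontally. -/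
open MeasureTheory

/-- The support function of a set `Ω ⊆ ℝ²`: `s_Ω(x) = sup_{v ∈ Ω} ⟨x, v⟩`. -/
noncomputable def suppFn (Ω : Set (ℝ × ℝ)) (x : ℝ × ℝ) : ℝ :=
  sSup ((fun v : ℝ × ℝ => x.1 * v.1 + x.2 * v.2) '' Ω)

open Set

theorem bddAbove_pairing_image {Ω : Set (ℝ × ℝ)} (hΩ : IsCompact Ω) (w : ℝ × ℝ) :
    BddAbove ((fun v : ℝ × ℝ => w.1 * v.1 + w.2 * v.2) '' Ω) :=
  (hΩ.image (by fun_prop)).bddAbove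

theorem le_suppFn {Ω : Set (ℝ × ℝ)} (hΩ : IsCompact Ω) (w : ℝ × ℝ) {v : ℝ × ℝ} (hv : v ∈ Ω) :
    w.1 * v.1 + w.2 * v.2 ≤ suppFn Ω w :=
  le_csSup (bddAbove_pairing_image hΩ w) (mem_image_of_mem _ hv)

/-- The support function of a nonempty compact set is Lipschitz. -/
theorem exists_lipschitzWith_suppFn {Ω : Set (ℝ × ℝ)} (hne : Ω.Nonempty) (hΩ : IsCompact Ω) :
    ∃ K, LipschitzWith K (suppFn Ω) := by
  obtain ⟨R, hR, hbound⟩ := hΩ.isBounded.exists_pos_norm_le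
  refine ⟨⟨2 * R, by positivity⟩, LipschitzWith.of_le_add_mul _ fun w z => ?_⟩
  refine csSup_le (hne.image _) ?_
  rintro _ ⟨v, hv, rfl⟩
  have hz := le_suppFn hΩ z hv
  have hv1 : |v.1| ≤ R := (norm_fst_le v).trans (hbound v hv)
  have hv2 : |v.2| ≤ R := (norm_snd_le v).trans (hbound v hv)
  have hd1 : |w.1 - z.1| ≤ dist w z := by
    rw [dist_eq_norm]; exact norm_fst_le (w - z)
  have hd2 : |w.2 - z.2| ≤ dist w z := by
    rw [dist_eq_norm]; exact norm_snd_le (w - z)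
  have h1 : (w.1 - z.1) * v.1 ≤ dist w z * R :=
    (le_abs_self _).trans (by rw [abs_mul]; gcongr)
  have h2 : (w.2 - z.2) * v.2 ≤ dist w z * R :=
    (le_abs_self _).trans (by rw [abs_mul]; gcongr)
  change _ ≤ suppFn Ω z + 2 * R * dist w z
  linarith

/-- An absolutely continuous function on `[a, b]` whose derivative vanishes almost everywhere in
the interior is constant. -/
theorem AbsolutelyContinuousOnInterval.eq_left_of_ae_hasDerivAt_zero_of_mem_Ioo
    {f : ℝ → ℝ} {a b : ℝ} (hab : a ≤ b) (hf : AbsolutelyContinuousOnInterval f a b)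
    (hf' : ∀ᵐ t, t ∈ Ioo a b → HasDerivAt f 0 t) : ∀ t ∈ Icc a b, f t = f a := by
  obtain ⟨C, hC⟩ := hf.const_of_ae_hasDerivAt_zero <| by
    filter_upwards [hf', Measure.ae_ne volume a, Measure.ae_ne volume b] with t ht ha hb hmem
    rw [uIcc_of_le hab] at hmem
    exact ht ⟨lt_of_le_of_ne hmem.1 ha.symm, lt_of_le_of_ne hmem.2 hb⟩
  rw [uIcc_of_le hab] at hC
  exact fun t ht => (hC t ht).trans (hC a (left_mem_Icc.2 hab)).symm

/-- Along any normal Pontryagin extremal of the Finsler problem on the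
Lobachevsky plane (`x' = y u₁`, `y' = y u₂`, adjoint `p = const`, `q' = -(p u₁ + q u₂)`,
with the maximality condition `p y u₁ + q y u₂ = s_Ω(p y, q y)`):
(a) `H = s_Ω(p y, q y)` is constant; (b) `C = p x + q y` is constant; hence for `p ≠ 0`
the trajectory lies in the curve `{(x, y) : s_Ω(p y, C - p x) = H}` — a rotated, dilated
and horizontally translated copy of the boundary of the polar set `Ω°`. -/
theorem stmt_16 (Ω : Set (ℝ × ℝ)) (hne : Ω.Nonempty) (hcomp : IsCompact Ω)
    (hconv : Convex ℝ Ω) (h0 : (0 : ℝ × ℝ) ∈ interior Ω)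
    (T : ℝ) (hT : 0 ≤ T) (x y q : ℝ → ℝ) (p : ℝ) (u : ℝ → ℝ × ℝ)
    (Kx Ky Kq : NNReal)
    (hxLip : LipschitzOnWith Kx x (Set.Icc 0 T))
    (hyLip : LipschitzOnWith Ky y (Set.Icc 0 T))
    (hqLip : LipschitzOnWith Kq q (Set.Icc 0 T))
    (hypos : ∀ t ∈ Set.Icc (0 : ℝ) T, 0 < y t)
    (humeas : Measurable u)
    (hsys : ∀ᵐ t ∂volume, t ∈ Set.Icc (0 : ℝ) T →
      u t ∈ Ω ∧
      HasDerivWithinAt x (y t * (u t).1) (Set.Icc 0 T) t ∧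
      HasDerivWithinAt y (y t * (u t).2) (Set.Icc 0 T) t ∧
      HasDerivWithinAt q (-(p * (u t).1 + q t * (u t).2)) (Set.Icc 0 T) t ∧
      p * y t * (u t).1 + q t * y t * (u t).2 = suppFn Ω (p * y t, q t * y t)) :
    (∀ t ∈ Set.Icc (0 : ℝ) T,
        suppFn Ω (p * y t, q t * y t) = suppFn Ω (p * y 0, q 0 * y 0)) ∧
    (∀ t ∈ Set.Icc (0 : ℝ) T, p * x t + q t * y t = p * x 0 + q 0 * y 0) ∧
    (p ≠ 0 → ∀ t ∈ Set.Icc (0 : ℝ) T,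
      suppFn Ω (p * y t, (p * x 0 + q 0 * y 0) - p * x t) =
        suppFn Ω (p * y 0, q 0 * y 0)) := by
  have hyAC : AbsolutelyContinuousOnInterval y 0 T :=
    LipschitzOnWith.absolutelyContinuousOnInterval (by rwa [uIcc_of_le hT])
  have hqAC : AbsolutelyContinuousOnInterval q 0 T :=
    LipschitzOnWith.absolutelyContinuousOnInterval (by rwa [uIcc_of_le hT])
  have hxAC : AbsolutelyContinuousOnInterval x 0 T :=
    LipschitzOnWith.absolutelyContinuousOnInterval (by rwa [uIcc_of_le hT])
  have hC : ∀ t ∈ Icc (0 : ℝ) T, p * x t + q t * y t = p * x 0 + q 0 * y 0 := by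
    refine ((hxAC.const_mul p).fun_add
      (hqAC.fun_mul hyAC)).eq_left_of_ae_hasDerivAt_zero_of_mem_Ioo hT ?_
    filter_upwards [hsys] with t ht hmem
    obtain ⟨-, hx, hy, hq, -⟩ := ht (Ioo_subset_Icc_self hmem)
    have hnhds := Icc_mem_nhds hmem.1 hmem.2
    refine (((hx.hasDerivAt hnhds).const_mul p).add
      ((hq.hasDerivAt hnhds).mul (hy.hasDerivAt hnhds))).congr_deriv ?_
    ring
  have hH : ∀ t ∈ Icc (0 : ℝ) T,
      suppFn Ω (p * y t, q t * y t) = suppFn Ω (p * y 0, q 0 * y 0) := by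
    obtain ⟨K, hK⟩ := exists_lipschitzWith_suppFn hne hcomp
    have hpair : LipschitzOnWith (max (‖p‖₊ * Ky) (‖p‖₊ * Kx))
        (fun t => (p * y t, q t * y t)) (Icc 0 T) := by
      refine LipschitzOnWith.prodMk ((lipschitzWith_smul p).comp_lipschitzOnWith hyLip) ?_
      refine LipschitzOnWith.of_dist_le_mul fun s hs t ht => ?_
      have hdist := ((lipschitzWith_smul p).comp_lipschitzOnWith hxLip).dist_le_mul s hs t ht
      have hst : q s * y s - q t * y t = -(p * x s - p * x t) := by
        linarith [hC s hs, hC t ht]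
      rw [Real.dist_eq, hst, abs_neg, ← Real.dist_eq]
      exact hdist
    have hHLip := hK.comp_lipschitzOnWith hpair
    have hHAC : AbsolutelyContinuousOnInterval
        (fun t => suppFn Ω (p * y t, q t * y t)) 0 T :=
      LipschitzOnWith.absolutelyContinuousOnInterval (by rw [uIcc_of_le hT]; exact hHLip)
    refine hHAC.eq_left_of_ae_hasDerivAt_zero_of_mem_Ioo hT ?_
    filter_upwards [hsys, hHAC.ae_differentiableAt] with t ht hdiff hmem
    have hmem' := Ioo_subset_Icc_self hmem
    obtain ⟨hu, -, hy, hq, hmax⟩ := ht hmem'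
    have hnhds := Icc_mem_nhds hmem.1 hmem.2
    have hH' := (hdiff (by rwa [uIcc_of_le hT])).hasDerivAt
    -- The pairing with the frozen control value supports `H` from below at `t`
    have hφ : HasDerivAt (fun s => p * y s * (u t).1 + q s * y s * (u t).2) 0 t := by
      refine ((((hy.hasDerivAt hnhds).const_mul p).mul_const (u t).1).add
        (((hq.hasDerivAt hnhds).mul (hy.hasDerivAt hnhds)).mul_const (u t).2)).congr_deriv ?_
      ring
    have hmin : IsLocalMin (fun s => suppFn Ω (p * y s, q s * y s) -
        (p * y s * (u t).1 + q s * y s * (u t).2)) t :=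
      Filter.Eventually.of_forall fun s => by
        have := le_suppFn hcomp (p * y s, q s * y s) hu
        simp only at this ⊢
        linarith
    have hzero := hmin.hasDerivAt_eq_zero (hH'.sub hφ)
    rw [sub_zero] at hzero
    rwa [hzero] at hH'
  refine ⟨hH, hC, fun _ t ht => ?_⟩
  rw [← hH t ht, ← hC t ht, add_sub_cancel_left]
end
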